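/- Fix a real β > 0, an integer N ≥ 1, and set h_w = log(e^{4β}/(e^{4β}−1)). Let Ω_N* = {ψ : Λ_N → ℤ : whenever ψ(x) ≤ −1, every y ∈ Λ_N with y ~ x satisfies ψ(y) ≥ 1}. Then for every φ : Λ_N → ℤ≥0, Σ_{ψ ∈ Ω_N* : max(ψ,0) = φ} exp( −β H_N(ψ) + h_w |q_{2+}(ψ)| ) = exp( −β H_N(φ) + h_w |φ^{−1}(0)| ), where the sum on the left converges. -/

import Mathlib

open Real Finset
open scoped Classical

noncomputable section

/-- The box `Λ_N = {1,…,N}²` in `ℤ²`. -/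
def Lam (N : ℕ) : Finset (ℤ × ℤ) := Finset.Icc (1:ℤ) (N:ℤ) ×ˢ Finset.Icc (1:ℤ) (N:ℤ)

/-- The four nearest neighbors of a site of `ℤ²`. -/
def nbrs (x : ℤ × ℤ) : Finset (ℤ × ℤ) :=
  {(x.1 + 1, x.2), (x.1 - 1, x.2), (x.1, x.2 + 1), (x.1, x.2 - 1)}

/-- An enlarged box containing all edges touching `Λ_N`. -/
def Box (N : ℕ) : Finset (ℤ × ℤ) := Finset.Icc (0:ℤ) ((N:ℤ)+1) ×ˢ Finset.Icc (0:ℤ) ((N:ℤ)+1)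

/-- The SOS Hamiltonian with zero boundary conditions, for fields vanishing outside `Λ_N`:
each edge `{x,y}` with `x ~ y` touching `Λ_N` is counted twice in the double sum (once from
each endpoint, both endpoints lying in `Box N`), whence the factor `1/2`.  Since the field
vanishes outside `Λ_N`, this equals
`Σ_{{x,y}⊂Λ_N, x~y} |φ(x)−φ(y)| + Σ_{x∈Λ_N, y∉Λ_N, x~y} |φ(x)|`. -/
def Ham (N : ℕ) (φ : ℤ × ℤ → ℤ) : ℝ :=
  (1/2) * ∑ x ∈ Box N, ∑ y ∈ nbrs x, |(φ x : ℝ) - (φ y : ℝ)|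

/-- The level set `φ⁻¹(k)` inside `Λ_N`. -/
def levelSet (N : ℕ) (φ : ℤ × ℤ → ℤ) (k : ℤ) : Finset (ℤ × ℤ) :=
  (Lam N).filter fun x => φ x = k

/-- The configuration space `Ω_N`: nonnegative integer fields vanishing outside `Λ_N`. -/
def Conf (N : ℕ) : Type :=
  {φ : ℤ × ℤ → ℤ // (∀ x, 0 ≤ φ x) ∧ ∀ x ∉ Lam N, φ x = 0}

/-- The Boltzmann weight `exp(−β H_N(φ) + h |φ⁻¹(0)|)`. -/
def weight (N : ℕ) (β h : ℝ) (φ : ℤ × ℤ → ℤ) : ℝ :=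
  Real.exp (-β * Ham N φ + h * ((levelSet N φ 0).card : ℝ))

/-- The partition function `Z_N^{β,h}`. -/
def Z (N : ℕ) (β h : ℝ) : ℝ := ∑' φ : Conf N, weight N β h φ.val

/-- The probability of an event `E ⊆ Ω_N` under `P_N^{β,h}`. -/
def prob (N : ℕ) (β h : ℝ) (E : Set (Conf N)) : ℝ :=
  (∑' φ : Conf N, if φ ∈ E then weight N β h φ.val else 0) / Z N β h

/-- The critical pinning value `h_w(β) = log(e^{4β}/(e^{4β}−1))`. -/
def hw (β : ℝ) : ℝ := Real.log (Real.exp (4*β) / (Real.exp (4*β) - 1))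

/-- The set `q_{2+}(φ)` of non-isolated zeros of `φ` in `Λ_N`: sites `x ∈ Λ_N` at height `0`
having a nearest neighbor `y ∈ Λ_N` also at height `0`. -/
def q2p (N : ℕ) (φ : ℤ × ℤ → ℤ) : Finset (ℤ × ℤ) :=
  (Lam N).filter fun x => φ x = 0 ∧ ∃ y ∈ nbrs x ∩ Lam N, φ y = 0

/-- The extended state space `Ω_N*`: integer fields vanishing outside `Λ_N` such that every
site of `Λ_N` at height `≤ −1` has all its nearest neighbors in `Λ_N` at height `≥ 1`. -/
def ConfStar (N : ℕ) : Type :=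
  {ψ : ℤ × ℤ → ℤ // (∀ x ∉ Lam N, ψ x = 0) ∧
    ∀ x ∈ Lam N, ψ x ≤ -1 → ∀ y ∈ Lam N, y ∈ nbrs x → 1 ≤ ψ y}

/-- The isolated zeros of `φ` in `Λ_N`. -/
def isolatedZeros (N : ℕ) (φ : ℤ × ℤ → ℤ) : Finset (ℤ × ℤ) :=
  levelSet N φ 0 \ q2p N φ

lemma mem_nbrs_comm {x y : ℤ × ℤ} : y ∈ nbrs x ↔ x ∈ nbrs y := by
  obtain ⟨a, b⟩ := x
  obtain ⟨c, d⟩ := y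
  simp only [nbrs, Finset.mem_insert, Finset.mem_singleton, Prod.mk.injEq]
  omega

lemma sum_nbrs (x : ℤ × ℤ) (f : ℤ × ℤ → ℝ) :
    ∑ y ∈ nbrs x, f y =
      f (x + (1, 0)) + f (x + (-1, 0)) + f (x + (0, 1)) + f (x + (0, -1)) := by
  obtain ⟨a, b⟩ := x
  rw [nbrs, Finset.sum_insert, Finset.sum_insert, Finset.sum_insert, Finset.sum_singleton]
  · simp [sub_eq_add_neg, add_assoc]
  all_goals
    simp only [Finset.mem_insert, Finset.mem_singleton, Prod.mk.injEq]
    omega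

lemma mem_Lam {N : ℕ} {x : ℤ × ℤ} :
    x ∈ Lam N ↔ (1 ≤ x.1 ∧ x.1 ≤ N) ∧ 1 ≤ x.2 ∧ x.2 ≤ N := by
  simp [Lam]

lemma mem_Box {N : ℕ} {x : ℤ × ℤ} :
    x ∈ Box N ↔ (0 ≤ x.1 ∧ x.1 ≤ N + 1) ∧ 0 ≤ x.2 ∧ x.2 ≤ N + 1 := by
  simp [Box]

/-- Summing over the enlarged box a function supported in `Λ_N` and shifted by at most one unit
in each direction. -/
lemma sum_Box_shift {N : ℕ} {f : ℤ × ℤ → ℝ} (hf : ∀ x ∉ Lam N, f x = 0) (e : ℤ × ℤ)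
    (h₁ : |e.1| ≤ 1) (h₂ : |e.2| ≤ 1) :
    ∑ x ∈ Box N, f (x + e) = ∑ x ∈ Lam N, f x := by
  rw [← Finset.sum_image (f := f) (g := fun x => x + e) (add_left_injective e).injOn]
  symm
  apply Finset.sum_subset
  · intro x hx
    rw [abs_le] at h₁ h₂
    rw [mem_Lam] at hx
    refine Finset.mem_image.2 ⟨x - e, ?_, by simp⟩
    rw [mem_Box, Prod.fst_sub, Prod.snd_sub]
    omega
  · exact fun x _ hx => hf x hx

lemma sum_Box_sum_nbrs_add {N : ℕ} {f : ℤ × ℤ → ℝ} (hf : ∀ x ∉ Lam N, f x = 0) :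
    ∑ x ∈ Box N, ∑ y ∈ nbrs x, (f x + f y) = 8 * ∑ x ∈ Lam N, f x := by
  have h₀ := sum_Box_shift hf 0 (by simp) (by simp)
  simp only [add_zero] at h₀
  simp only [sum_nbrs, Finset.sum_add_distrib, h₀]
  rw [sum_Box_shift hf (1, 0) (by simp) (by simp), sum_Box_shift hf (-1, 0) (by simp) (by simp),
    sum_Box_shift hf (0, 1) (by simp) (by simp), sum_Box_shift hf (0, -1) (by simp) (by simp)]
  ring

namespace ConfStar

variable {N : ℕ} (ψ : ConfStar N)

lemma abs_sub_eq {x y : ℤ × ℤ} (hxy : y ∈ nbrs x) :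
    |ψ.val x - ψ.val y| =
      |max (ψ.val x) 0 - max (ψ.val y) 0| + (max (-ψ.val x) 0 + max (-ψ.val y) 0) := by
  have key : ∀ {x y : ℤ × ℤ}, y ∈ nbrs x → ψ.val x ≤ -1 → 0 ≤ ψ.val y := by
    intro x y hxy hx
    by_cases hy : y ∈ Lam N
    · have hxL : x ∈ Lam N := by
        by_contra h
        rw [ψ.2.1 x h] at hx
        omega
      have := ψ.2.2 x hxL hx y hy hxy
      omega
    · exact (ψ.2.1 y hy).ge
  have h₁ := key hxy
  have h₂ := key (mem_nbrs_comm.1 hxy)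
  grind

/-- Lowering isolated zeros costs four units of energy per unit of height. -/
lemma ham_eq :
    Ham N ψ.val =
      Ham N (fun x => max (ψ.val x) 0) + 4 * ∑ x ∈ Lam N, ((max (-ψ.val x) 0 : ℤ) : ℝ) := by
  have h : ∀ x ∈ Box N, ∑ y ∈ nbrs x, |(ψ.val x : ℝ) - (ψ.val y : ℝ)| =
      ∑ y ∈ nbrs x, |((max (ψ.val x) 0 : ℤ) : ℝ) - ((max (ψ.val y) 0 : ℤ) : ℝ)| +
        ∑ y ∈ nbrs x, (((max (-ψ.val x) 0 : ℤ) : ℝ) + ((max (-ψ.val y) 0 : ℤ) : ℝ)) := by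
    intro x _
    rw [← Finset.sum_add_distrib]
    refine Finset.sum_congr rfl fun y hy => ?_
    exact_mod_cast ψ.abs_sub_eq hy
  rw [Ham, Finset.sum_congr rfl h, Finset.sum_add_distrib,
    sum_Box_sum_nbrs_add (f := fun x => ((max (-ψ.val x) 0 : ℤ) : ℝ))
      (fun x hx => by simp [ψ.2.1 x hx]), Ham]
  ring

variable {φ : ℤ × ℤ → ℤ}

lemma mem_isolatedZeros_of_neg (hψ : ∀ x, max (ψ.val x) 0 = φ x) {x : ℤ × ℤ}
    (hx : ψ.val x ≤ -1) : x ∈ isolatedZeros N φ := by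
  have hxL : x ∈ Lam N := by
    by_contra h
    rw [ψ.2.1 x h] at hx
    omega
  have hx0 := hψ x
  simp only [isolatedZeros, levelSet, q2p, Finset.mem_sdiff, Finset.mem_filter, Finset.mem_inter]
  refine ⟨⟨hxL, by omega⟩, ?_⟩
  rintro ⟨-, -, y, ⟨hyx, hyL⟩, hy⟩
  have := ψ.2.2 x hxL hx y hyL hyx
  have := hψ y
  omega

lemma q2p_eq (hψ : ∀ x, max (ψ.val x) 0 = φ x) : q2p N ψ.val = q2p N φ := by
  ext x
  simp only [q2p, Finset.mem_filter, Finset.mem_inter]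
  constructor
  · rintro ⟨hxL, hx, y, hy, hy0⟩
    exact ⟨hxL, by simp [← hψ, hx], y, hy, by simp [← hψ, hy0]⟩
  · rintro ⟨hxL, hx, y, ⟨hyx, hyL⟩, hy0⟩
    have h₁ := hψ x
    have h₂ := hψ y
    have h₃ := fun h => ψ.2.2 x hxL h y hyL hyx
    have h₄ := fun h => ψ.2.2 y hyL h x hxL (mem_nbrs_comm.1 hyx)
    exact ⟨hxL, by omega, y, ⟨hyx, hyL⟩, by omega⟩

lemma sum_negPart_eq (hψ : ∀ x, max (ψ.val x) 0 = φ x) :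
    ∑ x ∈ Lam N, ((max (-ψ.val x) 0 : ℤ) : ℝ) =
      ∑ x : isolatedZeros N φ, ((-ψ.val x).toNat : ℝ) := by
  rw [Finset.sum_coe_sort (isolatedZeros N φ) (fun x => ((-ψ.val x).toNat : ℝ))]
  symm
  have h : ∀ x, ((max (-ψ.val x) 0 : ℤ) : ℝ) = ((-ψ.val x).toNat : ℝ) := fun x => by
    rw [← Int.ofNat_toNat, Int.cast_natCast]
  simp only [h]
  refine Finset.sum_subset ?_ fun x _ hx => ?_
  · exact Finset.sdiff_subset.trans (Finset.filter_subset _ _)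
  · have : ¬ ψ.val x ≤ -1 := fun hneg => hx (ψ.mem_isolatedZeros_of_neg hψ hneg)
    rw [Nat.cast_eq_zero]
    omega

end ConfStar

/-- Fields in `Ω_N*` with positive part `φ` correspond to depths at the isolated zeros of `φ`. -/
def fiberEquiv {N : ℕ} (φ : Conf N) :
    {ψ : ConfStar N // ∀ x, max (ψ.val x) 0 = φ.val x} ≃ (isolatedZeros N φ.val → ℕ) where
  toFun ψ x := (-ψ.val.val x).toNat
  invFun n := ⟨⟨fun x => if h : x ∈ isolatedZeros N φ.val then -(n ⟨x, h⟩ : ℤ) else φ.val x, by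
      constructor
      · intro x hx
        have : x ∉ isolatedZeros N φ.val := by simp [isolatedZeros, levelSet, hx]
        simp [this, φ.2.2 x hx]
      · intro x hxL hx y hyL hyx
        have hxI : x ∈ isolatedZeros N φ.val := by
          by_contra h
          have := φ.2.1 x
          simp only [h, dite_false] at hx
          omega
        have hx0 : φ.val x = 0 := by
          simp only [isolatedZeros, levelSet, Finset.mem_sdiff, Finset.mem_filter] at hxI
          exact hxI.1.2
        have hy0 : φ.val y ≠ 0 := by
          intro hy0
          refine (Finset.mem_sdiff.1 hxI).2 (Finset.mem_filter.2 ⟨hxL, hx0, y, ?_, hy0⟩)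
          exact Finset.mem_inter.2 ⟨hyx, hyL⟩
        have hyI : y ∉ isolatedZeros N φ.val := by simp [isolatedZeros, levelSet, hy0]
        have := φ.2.1 y
        simp only [hyI, dite_false]
        omega⟩, by
      intro x
      by_cases hx : x ∈ isolatedZeros N φ.val
      · have hx0 : φ.val x = 0 := by
          simp only [isolatedZeros, levelSet, Finset.mem_sdiff, Finset.mem_filter] at hx
          exact hx.1.2
        simp [hx, hx0]
      · simp [hx, φ.2.1 x]⟩
  left_inv ψ := by
    ext1
    apply Subtype.ext
    funext x
    have h := ψ.2 x
    by_cases hx : x ∈ isolatedZeros N φ.val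
    · have hx0 : φ.val x = 0 := by
        simp only [isolatedZeros, levelSet, Finset.mem_sdiff, Finset.mem_filter] at hx
        exact hx.1.2
      simp only [hx, dite_true]
      omega
    · have : ¬ ψ.val.val x ≤ -1 := fun hneg => hx (ψ.val.mem_isolatedZeros_of_neg ψ.2 hneg)
      simp only [hx, dite_false]
      omega
  right_inv n := by
    funext x
    simp

/-- A finite product of sums of nonnegative series is the sum of the products. -/
lemma hasSum_pi_prod {ι κ : Type*} [Fintype ι] {f : ι → κ → ℝ} {a : ι → ℝ}
    (hf : ∀ i, HasSum (f i) (a i)) (hf₀ : ∀ i k, 0 ≤ f i k) :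
    HasSum (fun n : ι → κ => ∏ i, f i (n i)) (∏ i, a i) := by
  have key : ∀ [Fintype ι] (f : ι → κ → ℝ) (a : ι → ℝ), (∀ i, HasSum (f i) (a i)) →
      (∀ i k, 0 ≤ f i k) → HasSum (fun n : ι → κ => ∏ i, f i (n i)) (∏ i, a i) := by
    clear hf hf₀ f a
    induction ι using Finite.induction_empty_option with
    | of_equiv e ih =>
      intro _ f a hf hf₀
      have _ := Fintype.ofEquiv _ e.symm
      have h := ih (fun i => f (e i)) (fun i => a (e i)) (fun i => hf (e i)) fun i => hf₀ (e i)
      rw [e.prod_comp, ← (Equiv.arrowCongr e (Equiv.refl κ)).symm.hasSum_iff] at h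
      convert h using 1
      funext n
      simp [← e.prod_comp]
    | h_empty =>
      intro _ f a _ _
      simp
    | h_option ih =>
      intro inst f a hf hf₀
      obtain rfl : inst = instFintypeOption := Subsingleton.elim _ _
      have h := ih (fun i => f (some i)) (fun i => a (some i)) (fun i => hf (some i))
        fun i => hf₀ (some i)
      have hmul := (hf none).mul h ((hf none).summable.mul_of_nonneg h.summable (hf₀ none)
        fun n => Finset.prod_nonneg fun i _ => hf₀ (some i) (n i))
      rw [← (Equiv.piOptionEquivProd (β := fun _ : Option _ => κ)).hasSum_iff] at hmul
      simpa only [Function.comp_def, Fintype.prod_option] using! hmul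
  exact key f a hf hf₀

lemma exp_hw {β : ℝ} (hβ : 0 < β) : Real.exp (hw β) = (1 - Real.exp (-(4 * β)))⁻¹ := by
  have h : 1 < Real.exp (4 * β) := Real.one_lt_exp_iff.2 (by positivity)
  rw [hw, Real.exp_log (div_pos (Real.exp_pos _) (sub_pos.2 h)), Real.exp_neg]
  have := sub_pos.2 h
  field_simp

lemma card_levelSet_zero (N : ℕ) (φ : ℤ × ℤ → ℤ) :
    (levelSet N φ 0).card = (q2p N φ).card + (isolatedZeros N φ).card := by
  have h : q2p N φ ⊆ levelSet N φ 0 := by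
    intro x
    simp only [q2p, levelSet, Finset.mem_filter]
    tauto
  rw [isolatedZeros, add_comm, Finset.card_sdiff_add_card_eq_card h]

lemma fiber_weight_eq {N : ℕ} (β : ℝ) (φ : Conf N)
    (ψ : {ψ : ConfStar N // ∀ x, max (ψ.val x) 0 = φ.val x}) :
    Real.exp (-β * Ham N ψ.val.val + hw β * ((q2p N ψ.val.val).card : ℝ)) =
      Real.exp (-β * Ham N φ.val + hw β * ((q2p N φ.val).card : ℝ)) *
        ∏ x, Real.exp (-(4 * β)) ^ fiberEquiv φ ψ x := by
  simp only [← Real.exp_nat_mul, ← Real.exp_sum, ← Real.exp_add, ← Finset.sum_mul]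
  rw [ψ.val.q2p_eq ψ.2, ψ.val.ham_eq, ψ.val.sum_negPart_eq ψ.2, funext ψ.2]
  congr 1
  simp only [fiberEquiv, Equiv.coe_fn_mk]
  ring

/-- Resummation identity at criticality: for every `φ ∈ Ω_N`, summing the weights
`exp(−β H_N(ψ) + h_w |q_{2+}(ψ)|)` over all `ψ ∈ Ω_N*` with `max(ψ,0) = φ` gives back the
pinned weight `exp(−β H_N(φ) + h_w |φ⁻¹(0)|)` (and the sum converges). -/
theorem fiber_resummation_at_criticality (β : ℝ) (hβ : 0 < β) (N : ℕ) (hN : 1 ≤ N)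
    (φ : Conf N) :
    Summable (fun ψ : {ψ : ConfStar N // ∀ x, max (ψ.val x) 0 = φ.val x} =>
        Real.exp (-β * Ham N ψ.val.val + hw β * ((q2p N ψ.val.val).card : ℝ))) ∧
      (∑' ψ : {ψ : ConfStar N // ∀ x, max (ψ.val x) 0 = φ.val x},
          Real.exp (-β * Ham N ψ.val.val + hw β * ((q2p N ψ.val.val).card : ℝ))) =
        Real.exp (-β * Ham N φ.val + hw β * ((levelSet N φ.val 0).card : ℝ)) := by
  have h₁ : Real.exp (-(4 * β)) < 1 := Real.exp_lt_one_iff.2 (by linarith)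
  have hgeom := (hasSum_pi_prod (ι := isolatedZeros N φ.val)
    (fun _ => hasSum_geometric_of_lt_one (Real.exp_pos _).le h₁)
    (fun _ k => pow_nonneg (Real.exp_pos _).le k)).mul_left
      (Real.exp (-β * Ham N φ.val + hw β * ((q2p N φ.val).card : ℝ)))
  rw [← (fiberEquiv φ).hasSum_iff] at hgeom
  have hsum : HasSum (fun ψ : {ψ : ConfStar N // ∀ x, max (ψ.val x) 0 = φ.val x} =>
      Real.exp (-β * Ham N ψ.val.val + hw β * ((q2p N ψ.val.val).card : ℝ)))
      (Real.exp (-β * Ham N φ.val + hw β * ((levelSet N φ.val 0).card : ℝ))) := by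
    simp only [fiber_weight_eq]
    rw [← exp_hw hβ, Finset.prod_const, Finset.card_univ, Fintype.card_coe,
      ← Real.exp_nat_mul, ← Real.exp_add] at hgeom
    rw [card_levelSet_zero, Nat.cast_add, mul_add, ← add_assoc,
      mul_comm (hw β) ((isolatedZeros N φ.val).card : ℝ)]
    exact hgeom
  exact ⟨hsum.summable, hsum.tsum_eq⟩
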